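/- For every natural number p ≥ 1 there exists a constant C > 0, depending only on p, such that for every h > 0 and every bivariate polynomial q of total degree ≤ p the following holds. Let q̂ be the unique bivariate polynomial of total degree ≤ p − 2 satisfying ∫_{(0,h)²} (q − q̂) m dx dy = 0 for every bivariate polynomial m of total degree ≤ p − 2 (with q̂ = 0 when p = 1). Then ∫_{(0,h)²} |∇q|² dx dy ≤ C ( h⁻¹ ∫_{∂((0,h)²)} q² dμ + h⁻² ∫_{(0,h)²} q̂² dx dy ), where the boundary integral is taken with respect to the one-dimensional Hausdorff (arclength) measure μ on the boundary of the square. -/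

import Mathlib

open MeasureTheory

/-- The space of bivariate real polynomials of total degree at most `k`, for an
integer `k` (so that `k < 0` gives the zero space, e.g. `P₋₁ = {0}`). -/
def polyLE (k : ℤ) : Set (MvPolynomial (Fin 2) ℝ) :=
  {m | m = 0 ∨ (0 ≤ k ∧ (m.totalDegree : ℤ) ≤ k)}

/-- Evaluation of a bivariate polynomial at a point of `ℝ × ℝ`. -/
noncomputable def evP (q : MvPolynomial (Fin 2) ℝ) (z : ℝ × ℝ) : ℝ :=
  MvPolynomial.eval ![z.1, z.2] q

/-- Squared Euclidean norm of the gradient of a bivariate polynomial. -/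
noncomputable def gradSqP (q : MvPolynomial (Fin 2) ℝ) (z : ℝ × ℝ) : ℝ :=
  (evP (MvPolynomial.pderiv (0 : Fin 2) q) z) ^ 2 +
    (evP (MvPolynomial.pderiv (1 : Fin 2) q) z) ^ 2

/-- Comparison of quadratic forms on a finite dimensional space. -/
theorem quad_compare {V : Type*} [AddCommGroup V] [Module ℝ V] [FiniteDimensional ℝ V]
    (A B : V →ₗ[ℝ] V →ₗ[ℝ] ℝ) (hB : ∀ x, x ≠ 0 → 0 < B x x) :
    ∃ C : ℝ, 0 < C ∧ ∀ x, A x x ≤ C * B x x := by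
  classical
  let n := Module.finrank ℝ V
  let e : EuclideanSpace ℝ (Fin n) ≃ₗ[ℝ] V :=
    LinearEquiv.ofFinrankEq _ _ (by simp [n])
  have cont : ∀ D : V →ₗ[ℝ] V →ₗ[ℝ] ℝ, Continuous fun x => D (e x) (e x) := by
    intro D
    let D' : EuclideanSpace ℝ (Fin n) →ₗ[ℝ] EuclideanSpace ℝ (Fin n) →ₗ[ℝ] ℝ :=
      D.compl₁₂ e.toLinearMap e.toLinearMap
    let D'' : EuclideanSpace ℝ (Fin n) →ₗ[ℝ] EuclideanSpace ℝ (Fin n) →L[ℝ] ℝ :=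
      LinearMap.toContinuousLinearMap.toLinearMap.comp D'
    have h : Continuous D'' := D''.continuous_of_finiteDimensional
    have : Continuous fun x => D'' x x := h.clm_apply continuous_id
    exact this
  have hpos : ∀ x ∈ Metric.sphere (0 : EuclideanSpace ℝ (Fin n)) 1, 0 < B (e x) (e x) := by
    intro x hx
    apply hB
    intro h0
    have : x = 0 := by simpa using h0
    simp [this] at hx
  have hc : ContinuousOn (fun x => A (e x) (e x) / B (e x) (e x))
      (Metric.sphere (0 : EuclideanSpace ℝ (Fin n)) 1) :=
    (cont A).continuousOn.div (cont B).continuousOn fun x hx => (hpos x hx).ne'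
  obtain ⟨C, hC⟩ := (isCompact_sphere (0 : EuclideanSpace ℝ (Fin n)) 1).bddAbove_image hc
  refine ⟨max C 1, by positivity, fun v => ?_⟩
  obtain ⟨x, rfl⟩ := e.surjective v
  by_cases hx : x = 0
  · simp [hx]
  have hn : 0 < ‖x‖ := norm_pos_iff.mpr hx
  set y := (‖x‖)⁻¹ • x with hy
  have hys : y ∈ Metric.sphere (0 : EuclideanSpace ℝ (Fin n)) 1 := by
    simp [hy, norm_smul, hn.ne']
  have h1 : A (e y) (e y) / B (e y) (e y) ≤ max C 1 :=
    (hC ⟨y, hys, rfl⟩).trans (le_max_left _ _)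
  rw [div_le_iff₀ (hpos y hys)] at h1
  have hxy : x = ‖x‖ • y := by simp [hy, smul_smul, hn.ne']
  rw [hxy]
  simp only [map_smul, LinearMap.smul_apply, smul_eq_mul]
  nlinarith [mul_le_mul_of_nonneg_left h1 (sq_nonneg ‖x‖)]

/-! ### Degrees -/

theorem pderiv2_mem (p : ℕ) (i : Fin 2) (q : MvPolynomial (Fin 2) ℝ) (hq : q.totalDegree ≤ p) :
    MvPolynomial.pderiv i (MvPolynomial.pderiv i q) ∈ polyLE ((p : ℤ) - 2) := by
  have key : ∀ m ∈ (MvPolynomial.pderiv i (MvPolynomial.pderiv i q)).support,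
      m.degree + 2 ≤ p := by
    intro m hm
    rw [MvPolynomial.mem_support_iff, MvPolynomial.coeff_pderiv, MvPolynomial.coeff_pderiv] at hm
    have h1 := left_ne_zero_of_mul (left_ne_zero_of_mul hm)
    have h2 := MvPolynomial.le_totalDegree (MvPolynomial.mem_support_iff.mpr h1)
    have h3 : ((m + Finsupp.single i 1 + Finsupp.single i 1).sum fun _ e => e)
        = (m + Finsupp.single i 1 + Finsupp.single i 1).degree := rfl
    rw [h3] at h2
    simp only [map_add, Finsupp.degree_single] at h2
    omega
  by_cases h0 : MvPolynomial.pderiv i (MvPolynomial.pderiv i q) = 0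
  · exact Or.inl h0
  · right
    obtain ⟨m, hm⟩ := MvPolynomial.support_nonempty.mpr h0
    have hp2 := key m hm
    have : (MvPolynomial.pderiv i (MvPolynomial.pderiv i q)).totalDegree ≤ p - 2 := by
      apply Finset.sup_le
      intro m hm
      have := key m hm
      have h3 : (m.sum fun _ e => e) = m.degree := rfl
      omega
    constructor <;> omega

/-- Scaling of the variables. -/
noncomputable def scl (h : ℝ) : MvPolynomial (Fin 2) ℝ →ₐ[ℝ] MvPolynomial (Fin 2) ℝ :=
  MvPolynomial.aeval fun i => MvPolynomial.C h * MvPolynomial.X i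

theorem evP_scl (h : ℝ) (q : MvPolynomial (Fin 2) ℝ) (z : ℝ × ℝ) :
    evP (scl h q) z = evP q (h • z) := by
  unfold evP scl
  induction q using MvPolynomial.induction_on with
  | C a => simp
  | add p q hp hq => rw [map_add, map_add, map_add, hp, hq]
  | mul_X p i hp =>
    rw [map_mul, map_mul, hp, map_mul]
    fin_cases i <;> simp

theorem evP_ext {p q : MvPolynomial (Fin 2) ℝ}
    (h : ∀ x ∈ Set.Ioo (0 : ℝ) 1, ∀ y ∈ Set.Ioo (0 : ℝ) 1, evP p (x, y) = evP q (x, y)) :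
    p = q := by
  apply MvPolynomial.funext_set (fun _ => Set.Ioo (0 : ℝ) 1)
    (fun _ => Set.Ioo_infinite one_pos)
  intro x hx
  have := h (x 0) (hx 0 trivial) (x 1) (hx 1 trivial)
  have hx' : ![x 0, x 1] = x := by ext i; fin_cases i <;> rfl
  simpa [evP, hx'] using this

theorem scl_scl (h : ℝ) (hh : h ≠ 0) (q : MvPolynomial (Fin 2) ℝ) :
    scl h (scl h⁻¹ q) = q := by
  apply evP_ext
  intro x _ y _
  rw [evP_scl, evP_scl, smul_smul, inv_mul_cancel₀ hh, one_smul]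

theorem pderiv_scl (h : ℝ) (q : MvPolynomial (Fin 2) ℝ) (i : Fin 2) :
    MvPolynomial.pderiv i (scl h q) = MvPolynomial.C h * scl h (MvPolynomial.pderiv i q) := by
  unfold scl
  induction q using MvPolynomial.induction_on with
  | C a => simp [MvPolynomial.algebraMap_eq]
  | add p q hp hq => rw [map_add, map_add, map_add, map_add, hp, hq, mul_add]
  | mul_X p j hp =>
    rw [map_mul, MvPolynomial.pderiv_mul, hp, MvPolynomial.pderiv_mul, MvPolynomial.aeval_X,
      MvPolynomial.pderiv_C_mul, map_add, map_mul, map_mul, MvPolynomial.aeval_X]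
    by_cases hij : j = i
    · subst hij; simp; ring
    · simp [MvPolynomial.pderiv_X_of_ne hij]; ring

theorem totalDegree_scl (h : ℝ) (q : MvPolynomial (Fin 2) ℝ) :
    (scl h q).totalDegree ≤ q.totalDegree := by
  conv_lhs => rw [q.as_sum]
  rw [map_sum]
  apply MvPolynomial.totalDegree_finsetSum_le
  intro m hm
  have : scl h (MvPolynomial.monomial m (q.coeff m))
      = MvPolynomial.monomial m (h ^ (m 0 + m 1) * q.coeff m) := by
    rw [MvPolynomial.monomial_eq, MvPolynomial.monomial_eq]
    rw [Finsupp.prod_fintype _ _ (by simp)]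
    simp [scl, MvPolynomial.algebraMap_eq, mul_pow, pow_add]
    ring
  rw [this]
  exact (MvPolynomial.totalDegree_monomial_le _ _).trans (MvPolynomial.le_totalDegree hm)

theorem scl_mem {k : ℤ} (h : ℝ) {m : MvPolynomial (Fin 2) ℝ} (hm : m ∈ polyLE k) :
    scl h m ∈ polyLE k := by
  rcases hm with rfl | ⟨h0, h1⟩
  · left; simp
  · right
    have := totalDegree_scl h m
    exact ⟨h0, by omega⟩

/-! ### Integrals -/

theorem evP_add (p q z) : evP (p + q) z = evP p z + evP q z := by simp [evP]
theorem evP_sub (p q z) : evP (p - q) z = evP p z - evP q z := by simp [evP]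
theorem evP_mul (p q z) : evP (p * q) z = evP p z * evP q z := by simp [evP]
theorem evP_smul (c : ℝ) (q z) : evP (c • q) z = c * evP q z := by
  simp [evP, MvPolynomial.smul_eval]

@[fun_prop]
theorem evP_cont (q) : Continuous (evP q) := by
  unfold evP
  refine (MvPolynomial.continuous_eval q).comp ?_
  refine continuous_pi fun i => ?_
  fin_cases i
  · exact continuous_fst
  · exact continuous_snd

theorem evP_intOn (q) (h : ℝ) :
    IntegrableOn (evP q) (Set.Ioo (0 : ℝ) h ×ˢ Set.Ioo (0 : ℝ) h) := by
  have : IntegrableOn (evP q) (Set.Icc (0 : ℝ) h ×ˢ Set.Icc (0 : ℝ) h) :=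
    (evP_cont q).continuousOn.integrableOn_compact (isCompact_Icc.prod isCompact_Icc)
  exact this.mono_set (Set.prod_mono Set.Ioo_subset_Icc_self Set.Ioo_subset_Icc_self)

/-- Integral over the square. -/
noncomputable def II (h : ℝ) : MvPolynomial (Fin 2) ℝ →ₗ[ℝ] ℝ where
  toFun q := ∫ z in Set.Ioo (0 : ℝ) h ×ˢ Set.Ioo (0 : ℝ) h, evP q z
  map_add' p q := by
    simp only [evP_add]
    exact integral_add (evP_intOn p h) (evP_intOn q h)
  map_smul' c q := by
    simp only [evP_smul]
    exact integral_const_mul _ _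

/-- Integral over the boundary of the square, edge by edge. -/
noncomputable def JJ (h : ℝ) : MvPolynomial (Fin 2) ℝ →ₗ[ℝ] ℝ where
  toFun q := (∫ t in (0 : ℝ)..h, evP q (t, 0)) + (∫ t in (0 : ℝ)..h, evP q (t, h))
    + (∫ t in (0 : ℝ)..h, evP q (0, t)) + (∫ t in (0 : ℝ)..h, evP q (h, t))
  map_add' p q := by
    simp only [evP_add]
    rw [intervalIntegral.integral_add, intervalIntegral.integral_add,
      intervalIntegral.integral_add, intervalIntegral.integral_add]
    · ring
    all_goals exact Continuous.intervalIntegrable (by fun_prop) _ _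
  map_smul' c q := by
    simp only [evP_smul, intervalIntegral.integral_const_mul, RingHom.id_apply, smul_eq_mul]
    ring

theorem II_apply (h q) : II h q = ∫ z in Set.Ioo (0 : ℝ) h ×ˢ Set.Ioo (0 : ℝ) h, evP q z := rfl
theorem JJ_apply (h q) : JJ h q = (∫ t in (0 : ℝ)..h, evP q (t, 0))
    + (∫ t in (0 : ℝ)..h, evP q (t, h))
    + (∫ t in (0 : ℝ)..h, evP q (0, t)) + (∫ t in (0 : ℝ)..h, evP q (h, t)) := rfl

open Pointwise in
theorem II_scl (h : ℝ) (hh : 0 < h) (q) : II 1 (scl h q) = h⁻¹ ^ 2 * II h q := by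
  rw [II_apply, II_apply]
  simp only [evP_scl]
  rw [Measure.setIntegral_comp_smul_of_pos _ _ _ hh]
  have : h • (Set.Ioo (0 : ℝ) 1 ×ˢ Set.Ioo (0 : ℝ) 1) = Set.Ioo (0 : ℝ) h ×ˢ Set.Ioo (0 : ℝ) h := by
    rw [Set.smul_set_prod, LinearOrderedField.smul_Ioo hh]
    simp
  rw [this]
  simp

theorem JJ_scl (h : ℝ) (hh : 0 < h) (q) : JJ 1 (scl h q) = h⁻¹ * JJ h q := by
  rw [JJ_apply, JJ_apply]
  simp only [evP_scl, Prod.smul_mk, smul_eq_mul, mul_zero, mul_one]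
  rw [intervalIntegral.integral_comp_mul_left (fun t => evP q (t, 0)) hh.ne',
    intervalIntegral.integral_comp_mul_left (fun t => evP q (t, h)) hh.ne',
    intervalIntegral.integral_comp_mul_left (fun t => evP q (0, t)) hh.ne',
    intervalIntegral.integral_comp_mul_left (fun t => evP q (h, t)) hh.ne']
  simp
  ring

theorem II_sq_nonneg (f) : 0 ≤ II 1 (f * f) := by
  rw [II_apply]
  exact integral_nonneg fun z => by rw [evP_mul]; exact mul_self_nonneg _

theorem II_sq_eq_zero {f} (h : II 1 (f * f) = 0) : f = 0 := by
  rw [II_apply, setIntegral_eq_zero_iff_of_nonneg_ae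
    (Filter.Eventually.of_forall fun z => by rw [evP_mul]; exact mul_self_nonneg _)
    (evP_intOn _ _)] at h
  have h2 : Set.EqOn (evP (f * f)) 0 (Set.Ioo (0 : ℝ) 1 ×ˢ Set.Ioo (0 : ℝ) 1) :=
    Measure.eqOn_open_of_ae_eq h (isOpen_Ioo.prod isOpen_Ioo) (evP_cont _).continuousOn
      continuousOn_const
  apply evP_ext
  intro x hx y hy
  have := h2 (show (x, y) ∈ _ from ⟨hx, hy⟩)
  rw [evP_mul] at this
  simpa [evP] using this

theorem edge_zero {g : ℝ → ℝ} (hg : Continuous g) (h0 : ∫ t in (0 : ℝ)..1, g t * g t = 0) :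
    ∀ t ∈ Set.Icc (0 : ℝ) 1, g t = 0 := by
  intro t ht
  by_contra hne
  have : 0 < ∫ t in (0 : ℝ)..1, g t * g t := by
    apply intervalIntegral.integral_pos one_pos (by fun_prop) (fun x _ => mul_self_nonneg _)
    exact ⟨t, ht, mul_self_pos.mpr hne⟩
  linarith

theorem edge_nonneg (g : ℝ → ℝ) : 0 ≤ ∫ t in (0 : ℝ)..1, g t * g t :=
  intervalIntegral.integral_nonneg zero_le_one fun _ _ => mul_self_nonneg _

theorem JJ_sq_nonneg (f) : 0 ≤ JJ 1 (f * f) := by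
  rw [JJ_apply]
  simp only [evP_mul]
  have h1 := edge_nonneg fun t => evP f (t, 0)
  have h2 := edge_nonneg fun t => evP f (t, 1)
  have h3 := edge_nonneg fun t => evP f (0, t)
  have h4 := edge_nonneg fun t => evP f (1, t)
  linarith

theorem JJ_sq_eq_zero {f} (h : JJ 1 (f * f) = 0) :
    ∀ t ∈ Set.Icc (0 : ℝ) 1, evP f (t, 0) = 0 ∧ evP f (t, 1) = 0 ∧ evP f (0, t) = 0 ∧
      evP f (1, t) = 0 := by
  rw [JJ_apply] at h
  simp only [evP_mul] at h
  have h1 := edge_nonneg fun t => evP f (t, 0)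
  have h2 := edge_nonneg fun t => evP f (t, 1)
  have h3 := edge_nonneg fun t => evP f (0, t)
  have h4 := edge_nonneg fun t => evP f (1, t)
  intro t ht
  refine ⟨edge_zero (g := fun t => evP f (t, 0)) (by fun_prop) (by linarith) t ht,
    edge_zero (g := fun t => evP f (t, 1)) (by fun_prop) (by linarith) t ht,
    edge_zero (g := fun t => evP f (0, t)) (by fun_prop) (by linarith) t ht,
    edge_zero (g := fun t => evP f (1, t)) (by fun_prop) (by linarith) t ht⟩

theorem deriv0 (q) (x y : ℝ) :
    HasDerivAt (fun t => evP q (t, y)) (evP (MvPolynomial.pderiv 0 q) (x, y)) x := by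
  induction q using MvPolynomial.induction_on with
  | C a => simpa [evP] using hasDerivAt_const x a
  | add p q hp hq =>
    simp only [evP_add, map_add]
    exact hp.add hq
  | mul_X p j hp =>
    simp only [evP_mul, evP_add, MvPolynomial.pderiv_mul]
    have hX : HasDerivAt (fun t => evP (MvPolynomial.X j) (t, y))
        (evP (MvPolynomial.pderiv 0 (MvPolynomial.X j)) (x, y)) x := by
      fin_cases j
      · simpa [evP] using hasDerivAt_id' x
      · simpa [evP] using hasDerivAt_const x y
    exact hp.mul hX

theorem deriv1 (q) (x y : ℝ) :
    HasDerivAt (fun t => evP q (x, t)) (evP (MvPolynomial.pderiv 1 q) (x, y)) y := by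
  induction q using MvPolynomial.induction_on with
  | C a => simpa [evP] using hasDerivAt_const y a
  | add p q hp hq =>
    simp only [evP_add, map_add]
    exact hp.add hq
  | mul_X p j hp =>
    simp only [evP_mul, evP_add, MvPolynomial.pderiv_mul]
    have hX : HasDerivAt (fun t => evP (MvPolynomial.X j) (x, t))
        (evP (MvPolynomial.pderiv 1 (MvPolynomial.X j)) (x, y)) y := by
      fin_cases j
      · simpa [evP] using hasDerivAt_const y x
      · simpa [evP] using hasDerivAt_id' y
    exact hp.mul hX

theorem II_eq_iter (q) : II 1 q = ∫ x in Set.Ioo (0 : ℝ) 1, ∫ y in Set.Ioo (0 : ℝ) 1, evP q (x, y) := by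
  rw [II_apply]
  exact setIntegral_prod _ (evP_intOn q 1)

theorem II_eq_iter' (q) :
    II 1 q = ∫ y in Set.Ioo (0 : ℝ) 1, ∫ x in Set.Ioo (0 : ℝ) 1, evP q (x, y) := by
  rw [II_eq_iter]
  apply integral_integral_swap
  have := evP_intOn q 1
  rw [IntegrableOn, Measure.volume_eq_prod, ← Measure.prod_restrict] at this
  exact this

theorem II_pderiv0 (f) (h0 : ∀ t ∈ Set.Icc (0 : ℝ) 1, evP f (0, t) = 0)
    (h1 : ∀ t ∈ Set.Icc (0 : ℝ) 1, evP f (1, t) = 0) :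
    II 1 (MvPolynomial.pderiv 0 f) = 0 := by
  rw [II_eq_iter']
  apply setIntegral_eq_zero_of_forall_eq_zero
  intro y hy
  rw [← integral_Ioc_eq_integral_Ioo, ← intervalIntegral.integral_of_le zero_le_one,
    intervalIntegral.integral_eq_sub_of_hasDerivAt (f := fun t => evP f (t, y))
      (fun x _ => deriv0 f x y) (Continuous.intervalIntegrable (by fun_prop) _ _),
    h0 y (Set.Ioo_subset_Icc_self hy), h1 y (Set.Ioo_subset_Icc_self hy), sub_zero]

theorem II_pderiv1 (f) (h0 : ∀ t ∈ Set.Icc (0 : ℝ) 1, evP f (t, 0) = 0)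
    (h1 : ∀ t ∈ Set.Icc (0 : ℝ) 1, evP f (t, 1) = 0) :
    II 1 (MvPolynomial.pderiv 1 f) = 0 := by
  rw [II_eq_iter]
  apply setIntegral_eq_zero_of_forall_eq_zero
  intro x hx
  rw [← integral_Ioc_eq_integral_Ioo, ← intervalIntegral.integral_of_le zero_le_one,
    intervalIntegral.integral_eq_sub_of_hasDerivAt (f := fun t => evP f (x, t))
      (fun y _ => deriv1 f x y) (Continuous.intervalIntegrable (by fun_prop) _ _),
    h0 x (Set.Ioo_subset_Icc_self hx), h1 x (Set.Ioo_subset_Icc_self hx), sub_zero]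

/-- Key uniqueness: zero boundary values and zero projection force `q = 0`. -/
theorem key_zero (p : ℕ) (q : MvPolynomial (Fin 2) ℝ) (hq : q.totalDegree ≤ p)
    (hI : ∀ m ∈ polyLE ((p : ℤ) - 2), II 1 (q * m) = 0) (hJ : JJ 1 (q * q) = 0) : q = 0 := by
  have hb := JJ_sq_eq_zero hJ
  have e0 := II_pderiv0 (q * MvPolynomial.pderiv 0 q)
    (fun t ht => by rw [evP_mul, (hb t ht).2.2.1, zero_mul])
    (fun t ht => by rw [evP_mul, (hb t ht).2.2.2, zero_mul])
  rw [MvPolynomial.pderiv_mul, map_add, hI _ (pderiv2_mem p 0 q hq), add_zero] at e0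
  have hd := II_sq_eq_zero e0
  apply evP_ext
  intro x hx y hy
  have hconst : evP q (x, y) = evP q (0, y) :=
    is_const_of_deriv_eq_zero (f := fun t => evP q (t, y))
      (fun t => (deriv0 q t y).differentiableAt)
      (fun t => by rw [(deriv0 q t y).deriv, hd]; simp [evP]) x 0
  rw [hconst, (hb y (Set.Ioo_subset_Icc_self hy)).2.2.1]
  simp [evP]

/-! ### Boundary integral -/

theorem iso_h (c : ℝ) : Isometry fun t : ℝ => ((t, c) : ℝ × ℝ) := by
  apply Isometry.of_dist_eq
  intro a b
  simp [Prod.dist_eq]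

theorem iso_v (c : ℝ) : Isometry fun t : ℝ => ((c, t) : ℝ × ℝ) := by
  apply Isometry.of_dist_eq
  intro a b
  simp [Prod.dist_eq]

theorem edge_integral {φ : ℝ → ℝ × ℝ} (hφ : Isometry φ) (f : ℝ × ℝ → ℝ) (h : ℝ) (hh : 0 < h) :
    ∫ z in φ '' Set.Icc 0 h, f z ∂(μH[1]) = ∫ t in (0 : ℝ)..h, f (φ t) := by
  have he : MeasurableEmbedding φ := hφ.isClosedEmbedding.measurableEmbedding
  have h1 : (μH[1] : Measure (ℝ × ℝ)).restrict (φ '' Set.Icc 0 h)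
      = ((volume : Measure ℝ).restrict (Set.Icc 0 h)).map φ := by
    have hm := hφ.map_hausdorffMeasure (d := 1) (Or.inl zero_le_one)
    rw [hausdorffMeasure_real] at hm
    have hsub : φ '' Set.Icc 0 h ⊆ Set.range φ := Set.image_subset_range _ _
    rw [← Measure.restrict_restrict_of_subset hsub, ← hm, he.restrict_map,
      Set.preimage_image_eq _ hφ.injective]
  rw [h1, he.integral_map, integral_Icc_eq_integral_Ioc, intervalIntegral.integral_of_le hh.le]

theorem edge_measure {φ : ℝ → ℝ × ℝ} (hφ : Isometry φ) (h : ℝ) :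
    (μH[1] : Measure (ℝ × ℝ)) (φ '' Set.Icc 0 h) < ⊤ := by
  rw [hφ.hausdorffMeasure_image (Or.inl zero_le_one), hausdorffMeasure_real]
  exact measure_Icc_lt_top

theorem frontier_sq (h : ℝ) (hh : 0 < h) :
    frontier (Set.Ioo (0 : ℝ) h ×ˢ Set.Ioo (0 : ℝ) h) =
      ((fun t : ℝ => ((t, 0) : ℝ × ℝ)) '' Set.Icc 0 h ∪
        (fun t : ℝ => ((t, h) : ℝ × ℝ)) '' Set.Icc 0 h) ∪
      ((fun t : ℝ => ((0, t) : ℝ × ℝ)) '' Set.Icc 0 h ∪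
        (fun t : ℝ => ((h, t) : ℝ × ℝ)) '' Set.Icc 0 h) := by
  rw [frontier_prod_eq, closure_Ioo hh.ne, frontier_Ioo hh]
  ext ⟨x, y⟩
  simp only [Set.mem_union, Set.mem_prod, Set.mem_insert_iff, Set.mem_singleton_iff,
    Set.mem_image, Prod.mk.injEq]
  grind

theorem JJ_le (h : ℝ) (hh : 0 < h) (q : MvPolynomial (Fin 2) ℝ) :
    JJ h (q * q) ≤ 4 * ∫ z in frontier (Set.Ioo (0 : ℝ) h ×ˢ Set.Ioo (0 : ℝ) h),
      (evP q z) ^ 2 ∂(μH[1]) := by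
  have hfin : (μH[1] : Measure (ℝ × ℝ))
      (frontier (Set.Ioo (0 : ℝ) h ×ˢ Set.Ioo (0 : ℝ) h)) ≠ ⊤ := by
    rw [frontier_sq h hh]
    exact (measure_union_lt_top
      (measure_union_lt_top (edge_measure (iso_h 0) h) (edge_measure (iso_h h) h))
      (measure_union_lt_top (edge_measure (iso_v 0) h) (edge_measure (iso_v h) h))).ne
  have hcomp : IsCompact (frontier (Set.Ioo (0 : ℝ) h ×ˢ Set.Ioo (0 : ℝ) h)) := by
    apply Metric.isCompact_of_isClosed_isBounded isClosed_frontier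
    rw [frontier_sq h hh]
    have hb : ∀ {φ : ℝ → ℝ × ℝ}, Isometry φ → Bornology.IsBounded (φ '' Set.Icc 0 h) :=
      fun hφ => (isCompact_Icc.image hφ.continuous).isBounded
    exact ((hb (iso_h 0)).union (hb (iso_h h))).union ((hb (iso_v 0)).union (hb (iso_v h)))
  have hint : IntegrableOn (fun z => (evP q z) ^ 2)
      (frontier (Set.Ioo (0 : ℝ) h ×ˢ Set.Ioo (0 : ℝ) h)) (μH[1]) :=
    ContinuousOn.integrableOn_of_subset_isCompact
      (by fun_prop) hcomp hcomp.measurableSet subset_rfl hfin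
  have edge : ∀ {φ : ℝ → ℝ × ℝ}, Isometry φ →
      φ '' Set.Icc 0 h ⊆ frontier (Set.Ioo (0 : ℝ) h ×ˢ Set.Ioo (0 : ℝ) h) →
      ∫ t in (0 : ℝ)..h, evP (q * q) (φ t) ≤
        ∫ z in frontier (Set.Ioo (0 : ℝ) h ×ˢ Set.Ioo (0 : ℝ) h), (evP q z) ^ 2 ∂(μH[1]) := by
    intro φ hφ hs
    have := edge_integral hφ (fun z => (evP q z) ^ 2) h hh
    have hsq : ∀ z, evP (q * q) z = (evP q z) ^ 2 := fun z => by rw [evP_mul, pow_two]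
    simp only [hsq]
    rw [← this]
    exact setIntegral_mono_set hint (Filter.Eventually.of_forall fun z => sq_nonneg _)
      hs.eventuallyLE
  have h1 := edge (iso_h 0) (by rw [frontier_sq h hh]; intro z hz; exact Or.inl (Or.inl hz))
  have h2 := edge (iso_h h) (by rw [frontier_sq h hh]; intro z hz; exact Or.inl (Or.inr hz))
  have h3 := edge (iso_v 0) (by rw [frontier_sq h hh]; intro z hz; exact Or.inr (Or.inl hz))
  have h4 := edge (iso_v h) (by rw [frontier_sq h hh]; intro z hz; exact Or.inr (Or.inr hz))
  rw [JJ_apply]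
  linarith

/-! ### The finite dimensional space of pairs -/

/-- Pairs `(q, qhat)` of degree at most `p` with the orthogonality relation on the unit square. -/
noncomputable def LL (p : ℕ) : Submodule ℝ
    (MvPolynomial.restrictTotalDegree (Fin 2) ℝ p ×
      MvPolynomial.restrictTotalDegree (Fin 2) ℝ p) where
  carrier := {x | ∀ m ∈ polyLE ((p : ℤ) - 2),
    II 1 (((x.1 : MvPolynomial (Fin 2) ℝ) - (x.2 : MvPolynomial (Fin 2) ℝ)) * m) = 0}
  zero_mem' := by intro m _; simp
  add_mem' := by
    intro a b ha hb m hm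
    have := congrArg₂ (· + ·) (ha m hm) (hb m hm)
    simp only [← map_add, add_zero] at this
    rw [← this]
    congr 1
    simp only [Prod.fst_add, Prod.snd_add, Submodule.coe_add]
    ring
  smul_mem' := by
    intro c a ha m hm
    have := ha m hm
    simp only [Prod.smul_fst, Prod.smul_snd, Submodule.coe_smul, ← smul_sub, smul_mul_assoc,
      map_smul, this, smul_zero]

theorem unit_bound (p : ℕ) : ∃ C : ℝ, 0 < C ∧ ∀ q qhat : MvPolynomial (Fin 2) ℝ,
    q.totalDegree ≤ p → qhat.totalDegree ≤ p →
    (∀ m ∈ polyLE ((p : ℤ) - 2), II 1 ((q - qhat) * m) = 0) →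
    II 1 (MvPolynomial.pderiv 0 q * MvPolynomial.pderiv 0 q +
      MvPolynomial.pderiv 1 q * MvPolynomial.pderiv 1 q) ≤
      C * (JJ 1 (q * q) + II 1 (qhat * qhat)) := by
  let P := MvPolynomial (Fin 2) ℝ
  let π₁ : LL p →ₗ[ℝ] P := (Submodule.subtype _).comp ((LinearMap.fst ℝ _ _).comp (LL p).subtype)
  let π₂ : LL p →ₗ[ℝ] P := (Submodule.subtype _).comp ((LinearMap.snd ℝ _ _).comp (LL p).subtype)
  let M : P →ₗ[ℝ] P →ₗ[ℝ] P := LinearMap.mul ℝ P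
  let d0 : LL p →ₗ[ℝ] P := (MvPolynomial.pderiv (R := ℝ) (0 : Fin 2)).toLinearMap.comp π₁
  let d1 : LL p →ₗ[ℝ] P := (MvPolynomial.pderiv (R := ℝ) (1 : Fin 2)).toLinearMap.comp π₁
  let A : LL p →ₗ[ℝ] LL p →ₗ[ℝ] ℝ :=
    (M.compl₁₂ d0 d0).compr₂ (II 1) + (M.compl₁₂ d1 d1).compr₂ (II 1)
  let B : LL p →ₗ[ℝ] LL p →ₗ[ℝ] ℝ :=
    (M.compl₁₂ π₁ π₁).compr₂ (JJ 1) + (M.compl₁₂ π₂ π₂).compr₂ (II 1)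
  have hBv : ∀ x, B x x = JJ 1 (π₁ x * π₁ x) + II 1 (π₂ x * π₂ x) := fun x => rfl
  have hAv : ∀ x, A x x = II 1 (d0 x * d0 x) + II 1 (d1 x * d1 x) := fun x => rfl
  have hBpos : ∀ x, x ≠ 0 → 0 < B x x := by
    intro x hx
    have hJ := JJ_sq_nonneg (π₁ x)
    have hI := II_sq_nonneg (π₂ x)
    rw [hBv]
    by_contra hcon
    have hJ0 : JJ 1 (π₁ x * π₁ x) = 0 := by linarith
    have hI0 : II 1 (π₂ x * π₂ x) = 0 := by linarith
    have z2 : π₂ x = 0 := II_sq_eq_zero hI0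
    have z1 : π₁ x = 0 := by
      apply key_zero p _ ((MvPolynomial.mem_restrictTotalDegree _ _ _).mp x.1.1.2) _ hJ0
      intro m hm
      have := x.2 m hm
      change II 1 ((π₁ x - π₂ x) * m) = 0 at this
      rwa [z2, sub_zero] at this
    apply hx
    apply Subtype.ext
    exact Prod.ext (Subtype.ext z1) (Subtype.ext z2)
  obtain ⟨C, hC, hCb⟩ := quad_compare (V := LL p) A B hBpos
  refine ⟨C, hC, fun q qhat hq hqh ho => ?_⟩
  have := hCb ⟨(⟨q, (MvPolynomial.mem_restrictTotalDegree _ _ _).mpr hq⟩,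
    ⟨qhat, (MvPolynomial.mem_restrictTotalDegree _ _ _).mpr hqh⟩), ho⟩
  rw [hBv, hAv] at this
  rw [map_add]
  exact this

/-- lower stability bound for the "projected" stabilization on
square elements `K = (0,h)²`, for polynomials `q` of total degree ≤ p:
`|q|²_{1,K} ≤ C (h⁻¹ ‖q‖²_{0,∂K} + h⁻² ‖Π⁰_{p-2} q‖²_{0,K})`.
The boundary integral is with respect to the 1-dimensional Hausdorff measure. -/
theorem stmt_4 (p : ℕ) (hp : 1 ≤ p) :
    ∃ C : ℝ, 0 < C ∧ ∀ h : ℝ, 0 < h → ∀ q qhat : MvPolynomial (Fin 2) ℝ,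
      q.totalDegree ≤ p →
      qhat ∈ polyLE ((p : ℤ) - 2) →
      (∀ m ∈ polyLE ((p : ℤ) - 2),
        (∫ z in Set.Ioo (0 : ℝ) h ×ˢ Set.Ioo (0 : ℝ) h,
          (evP q z - evP qhat z) * evP m z) = 0) →
      (∫ z in Set.Ioo (0 : ℝ) h ×ˢ Set.Ioo (0 : ℝ) h, gradSqP q z) ≤
        C * (h⁻¹ * ∫ z in frontier (Set.Ioo (0 : ℝ) h ×ˢ Set.Ioo (0 : ℝ) h),
                (evP q z) ^ 2 ∂(μH[1]) +
             h⁻¹ ^ 2 * ∫ z in Set.Ioo (0 : ℝ) h ×ˢ Set.Ioo (0 : ℝ) h, (evP qhat z) ^ 2) := by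

  obtain ⟨C, hC, hb⟩ := unit_bound p
  refine ⟨4 * C, by positivity, fun h hh q qhat hq hqh ho => ?_⟩
  have hqh' : qhat.totalDegree ≤ p := by
    rcases hqh with rfl | ⟨_, h1⟩
    · simp
    · omega
  have key := hb (scl h q) (scl h qhat) ((totalDegree_scl h q).trans hq)
    ((totalDegree_scl h qhat).trans hqh') (by
      intro m hm
      have := ho (scl h⁻¹ m) (scl_mem _ hm)
      simp only [← evP_sub, ← evP_mul] at this
      rw [← II_apply] at this
      have h2 := II_scl h hh ((q - qhat) * scl h⁻¹ m)
      rw [this, map_mul, scl_scl h hh.ne', map_sub, mul_zero] at h2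
      exact h2)
  have e1 : II 1 (MvPolynomial.pderiv 0 (scl h q) * MvPolynomial.pderiv 0 (scl h q) +
      MvPolynomial.pderiv 1 (scl h q) * MvPolynomial.pderiv 1 (scl h q)) =
      ∫ z in Set.Ioo (0 : ℝ) h ×ˢ Set.Ioo (0 : ℝ) h, gradSqP q z := by
    have : MvPolynomial.pderiv 0 (scl h q) * MvPolynomial.pderiv 0 (scl h q) +
      MvPolynomial.pderiv 1 (scl h q) * MvPolynomial.pderiv 1 (scl h q) =
      (h ^ 2) • scl h (MvPolynomial.pderiv 0 q * MvPolynomial.pderiv 0 q +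
        MvPolynomial.pderiv 1 q * MvPolynomial.pderiv 1 q) := by
      rw [pderiv_scl, pderiv_scl, MvPolynomial.smul_eq_C_mul, map_add, map_mul, map_mul, map_pow]
      ring
    rw [this, map_smul, II_scl h hh, smul_eq_mul, ← mul_assoc, ← mul_pow, mul_inv_cancel₀ hh.ne',
      one_pow, one_mul, II_apply]
    simp only [evP_add, evP_mul, gradSqP, pow_two]
  have e2 : II h (qhat * qhat) =
      ∫ z in Set.Ioo (0 : ℝ) h ×ˢ Set.Ioo (0 : ℝ) h, (evP qhat z) ^ 2 := by
    rw [II_apply]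
    simp only [evP_mul, pow_two]
  have e3 := JJ_le h hh q
  have e4 : 0 ≤ II h (qhat * qhat) := by
    rw [e2]
    exact integral_nonneg fun z => sq_nonneg _
  rw [e1, ← map_mul, ← map_mul, JJ_scl h hh, II_scl h hh] at key
  rw [← e2]
  refine key.trans ?_
  rw [mul_comm 4 C, mul_assoc]
  refine mul_le_mul_of_nonneg_left ?_ hC.le
  have e5 := mul_le_mul_of_nonneg_left e3 (inv_nonneg.mpr hh.le)
  have e6 : 0 ≤ h⁻¹ ^ 2 * II h (qhat * qhat) := by positivity
  linarith
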